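/- arXiv:1908.06652 — 3 statements merged into one kernel-verified Lean document; each statement's English description precedes it below -/
import Mathlib

section
/- Let n ≥ 1, N = 2^n, 0 ≤ i < N/2, and 0 ≤ w ≤ N. Then S^{(n)}_{i,w} = Σ_{w'} S^{(n-1)}_{i,w'} · C(N/2 − w', (w − w')/2) · 2^{w'}, where the sum ranges over all integers w' with 0 ≤ w' ≤ min(w, N/2) and w' ≡ w (mod 2), and C(·,·) is the binomial coefficient. -/
/-- Arıkan's 2×2 polarization kernel over GF(2). -/
def G2 : Matrix (Fin 2) (Fin 2) (ZMod 2) := !![1, 0; 1, 1]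

/-- `G n` is the `n`-th Kronecker power `G₂^{⊗n}`, an `2^n × 2^n` matrix over GF(2).
The index `a * 2^n + b` corresponds to the pair `(a, b)`, so the most significant bit
comes from the leftmost Kronecker factor. -/
def G : (n : ℕ) → Matrix (Fin (2 ^ n)) (Fin (2 ^ n)) (ZMod 2)
  | 0 => 1
  | n + 1 =>
    Matrix.reindex (finProdFinEquiv.trans (finCongr (by ring)))
      (finProdFinEquiv.trans (finCongr (by ring)))
      (Matrix.kroneckerMap (· * ·) G2 (G n))

/-- The `i`-th row `g_i` of `G n`. -/
def row (n : ℕ) (i : Fin (2 ^ n)) : Fin (2 ^ n) → ZMod 2 := G n i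

/-- `bit i j` is the `j`-th bit in the binary representation of `i`. -/
def bit (i j : ℕ) : ℕ := i / 2 ^ j % 2

/-- The span of the rows `g_j` of `G n` with `j > i`. -/
def spanAbove (n : ℕ) (i : ℕ) : Submodule (ZMod 2) (Fin (2 ^ n) → ZMod 2) :=
  Submodule.span (ZMod 2) {v | ∃ j : Fin (2 ^ n), i < (j : ℕ) ∧ v = row n j}

/-- The one-coset `C^{(n)}(0^i, 1) = g_i + ⟨g_{i+1}, …, g_{N-1}⟩`. -/
def oneCoset (n : ℕ) (i : Fin (2 ^ n)) : Set (Fin (2 ^ n) → ZMod 2) :=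
  {x | ∃ v ∈ spanAbove n (i : ℕ), x = row n i + v}

/-- `S n i w` is the number of vectors of Hamming weight `w` in `C^{(n)}(0^i, 1)`. -/
noncomputable def S (n : ℕ) (i : Fin (2 ^ n)) (w : ℕ) : ℕ :=
  {x ∈ oneCoset n i | hammingNorm x = w}.ncard

/-- Concatenation of two vectors of length `2^n` into a vector of length `2^(n+1)`. -/
def app2 {n : ℕ} (a b : Fin (2 ^ n) → ZMod 2) : Fin (2 ^ (n + 1)) → ZMod 2 :=
  fun k => Fin.append a b (finCongr (by ring : 2 ^ (n + 1) = 2 ^ n + 2 ^ n) k)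

open Polynomial in
/-- Over GF(2), the generating function of the weights of `(y + u | u)` factors coordinatewise. -/
theorem sum_X_pow_hammingNorm_add {ι : Type*} [Fintype ι] [DecidableEq ι] (y : ι → ZMod 2) :
    ∑ u : ι → ZMod 2, (X : ℕ[X]) ^ (hammingNorm (y + u) + hammingNorm u) =
      (C 2 * X) ^ hammingNorm y * (1 + X ^ 2) ^ (Fintype.card ι - hammingNorm y) := by
  have hnorm (v : ι → ZMod 2) : hammingNorm v = ∑ k, if v k ≠ 0 then 1 else 0 := by
    rw [hammingNorm, Finset.card_filter]
  have hterm (u : ι → ZMod 2) : (X : ℕ[X]) ^ (hammingNorm (y + u) + hammingNorm u) =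
      ∏ k, X ^ ((if y k + u k ≠ 0 then 1 else 0) + if u k ≠ 0 then 1 else 0) := by
    rw [hnorm, hnorm, ← Finset.sum_add_distrib, Finset.prod_pow_eq_pow_sum]
    rfl
  have hfactor (a : ZMod 2) :
      ∑ b : ZMod 2, (X : ℕ[X]) ^ ((if a + b ≠ 0 then 1 else 0) + if b ≠ 0 then 1 else 0) =
        if a ≠ 0 then C 2 * X else 1 + X ^ 2 := by
    have hsum (f : ZMod 2 → ℕ[X]) : ∑ b, f b = f 0 + f 1 := Fin.sum_univ_two f
    have h11 : (1 : ZMod 2) + 1 = 0 := rfl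
    have ha : a = 0 ∨ a = 1 := by revert a; decide
    rcases ha with rfl | rfl
    · simp [hsum]
    · simp [hsum, h11, two_mul]
  have hcard : (Finset.univ.filter fun k => ¬ y k ≠ 0).card =
      Fintype.card ι - hammingNorm y := by
    have := Finset.card_filter_add_card_filter_not (s := Finset.univ) fun k => y k ≠ 0
    rw [Finset.card_univ] at this
    unfold hammingNorm
    omega
  simp_rw [hterm]
  rw [← Fintype.prod_sum fun k (b : ZMod 2) =>
    (X : ℕ[X]) ^ ((if y k + b ≠ 0 then 1 else 0) + if b ≠ 0 then 1 else 0)]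
  simp_rw [hfactor]
  rw [Finset.prod_ite, Finset.prod_const, Finset.prod_const, hcard]
  rfl

open Polynomial in
theorem card_hammingNorm_add_eq {ι : Type*} [Fintype ι] [DecidableEq ι] (y : ι → ZMod 2)
    (w : ℕ) :
    (Finset.univ.filter fun u : ι → ZMod 2 => hammingNorm (y + u) + hammingNorm u = w).card =
      if hammingNorm y ≤ w ∧ hammingNorm y % 2 = w % 2 then
        (Fintype.card ι - hammingNorm y).choose ((w - hammingNorm y) / 2) * 2 ^ hammingNorm y
      else 0 := by
  have h := congrArg (fun p => coeff p w) (sum_X_pow_hammingNorm_add y)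
  have hexp (m : ℕ) : (1 + X ^ 2 : ℕ[X]) ^ m = expand ℕ 2 ((1 + X) ^ m) := by simp
  simp only [finsetSum_coeff, coeff_X_pow] at h
  rw [Finset.card_filter]
  simp_rw [eq_comm (b := w)]
  rw [h, mul_pow, ← C_pow, mul_assoc, coeff_C_mul, coeff_X_pow_mul', hexp,
    coeff_expand two_pos, coeff_one_add_X_pow]
  by_cases hle : hammingNorm y ≤ w
  · by_cases hmod : hammingNorm y % 2 = w % 2
    · have : 2 ∣ w - hammingNorm y := by omega
      simp [hle, hmod, this, mul_comm]
    · have : ¬ 2 ∣ w - hammingNorm y := by omega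
      simp [hmod, this]
  · simp [hle]

/-- The index equivalence used in the recursive definition of `G`. -/
def indexEquiv (n : ℕ) : Fin 2 × Fin (2 ^ n) ≃ Fin (2 ^ (n + 1)) :=
  finProdFinEquiv.trans (finCongr (by ring))

theorem indexEquiv_val (n : ℕ) (a : Fin 2) (b : Fin (2 ^ n)) :
    (indexEquiv n (a, b) : ℕ) = b + 2 ^ n * a := rfl

theorem row_indexEquiv (n : ℕ) (a c : Fin 2) (b d : Fin (2 ^ n)) :
    row (n + 1) (indexEquiv n (a, b)) (indexEquiv n (c, d)) = G2 a c * row n b d := by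
  change G2 ((indexEquiv n).symm (indexEquiv n (a, b))).1
      ((indexEquiv n).symm (indexEquiv n (c, d))).1 *
    G n ((indexEquiv n).symm (indexEquiv n (a, b))).2
      ((indexEquiv n).symm (indexEquiv n (c, d))).2 = _
  simp [row]

theorem G_mul_self (n : ℕ) : G n * G n = 1 := by
  induction n with
  | zero => exact one_mul 1
  | succ n ih =>
    have hG2 : G2 * G2 = 1 := by decide
    change Matrix.submatrix (Matrix.kroneckerMap (· * ·) G2 (G n)) (indexEquiv n).symm (indexEquiv n).symm *
      Matrix.submatrix (Matrix.kroneckerMap (· * ·) G2 (G n)) (indexEquiv n).symm (indexEquiv n).symm = 1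
    rw [Matrix.submatrix_mul_equiv, ← Matrix.mul_kronecker_mul, ih, hG2, Matrix.one_kronecker_one,
      Matrix.submatrix_one_equiv]

theorem span_range_row (n : ℕ) : Submodule.span (ZMod 2) (Set.range (row n)) = ⊤ := by
  refine eq_top_iff.2 fun u _ => ?_
  have hu : u = ∑ j, Matrix.vecMul u (G n) j • row n j := by
    conv_lhs => rw [← Matrix.vecMul_one u, ← G_mul_self, ← Matrix.vecMul_vecMul]
    exact Matrix.vecMul_eq_sum _ _
  rw [hu]
  exact Submodule.sum_mem _ fun j _ =>
    Submodule.smul_mem _ _ (Submodule.subset_span (Set.mem_range_self j))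

/-- Plotkin's `(y + u | u)` construction. -/
def plotkin (n : ℕ) :
    ((Fin (2 ^ n) → ZMod 2) × (Fin (2 ^ n) → ZMod 2)) ≃ₗ[ZMod 2] (Fin (2 ^ (n + 1)) → ZMod 2) where
  toFun p k := (if ((indexEquiv n).symm k).1 = 0 then p.1 ((indexEquiv n).symm k).2 else 0) +
    p.2 ((indexEquiv n).symm k).2
  map_add' p q := by
    ext k
    simp only [Pi.add_apply, Prod.fst_add, Prod.snd_add]
    split_ifs <;> ring
  map_smul' c p := by
    ext k
    simp only [Pi.smul_apply, Prod.smul_fst, Prod.smul_snd, smul_eq_mul, RingHom.id_apply]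
    split_ifs <;> ring
  invFun x := (fun d => x (indexEquiv n (0, d)) - x (indexEquiv n (1, d)),
    fun d => x (indexEquiv n (1, d)))
  left_inv p := by ext d <;> simp
  right_inv x := by
    ext k
    obtain ⟨⟨a, d⟩, rfl⟩ := (indexEquiv n).surjective k
    fin_cases a <;> simp

theorem plotkin_indexEquiv (n : ℕ) (y u : Fin (2 ^ n) → ZMod 2) (a : Fin 2) (d : Fin (2 ^ n)) :
    plotkin n (y, u) (indexEquiv n (a, d)) = (if a = 0 then y d else 0) + u d := by
  simp [plotkin]

theorem row_zero_eq_plotkin (n : ℕ) (j : Fin (2 ^ n)) :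
    row (n + 1) (indexEquiv n (0, j)) = plotkin n (row n j, 0) := by
  ext k
  obtain ⟨⟨c, d⟩, rfl⟩ := (indexEquiv n).surjective k
  rw [row_indexEquiv, plotkin_indexEquiv]
  fin_cases c <;> simp [G2]

theorem row_one_eq_plotkin (n : ℕ) (j : Fin (2 ^ n)) :
    row (n + 1) (indexEquiv n (1, j)) = plotkin n (0, row n j) := by
  ext k
  obtain ⟨⟨c, d⟩, rfl⟩ := (indexEquiv n).surjective k
  rw [row_indexEquiv, plotkin_indexEquiv]
  fin_cases c <;> simp [G2]

theorem hammingNorm_plotkin (n : ℕ) (y u : Fin (2 ^ n) → ZMod 2) :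
    hammingNorm (plotkin n (y, u)) = hammingNorm (y + u) + hammingNorm u := by
  simp only [hammingNorm, Finset.card_filter]
  rw [← (indexEquiv n).sum_comp, Fintype.sum_prod_type, Fin.sum_univ_two]
  simp [plotkin_indexEquiv]

theorem plotkin_mem_spanAbove (n i : ℕ) (hi : i < 2 ^ n) (y u : Fin (2 ^ n) → ZMod 2) :
    plotkin n (y, u) ∈ spanAbove (n + 1) i ↔ y ∈ spanAbove n i := by
  constructor
  · intro h
    have hle : spanAbove (n + 1) i ≤
        (spanAbove n i).comap (LinearMap.fst (ZMod 2) _ _ ∘ₗ (plotkin n).symm.toLinearMap) := by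
      refine Submodule.span_le.2 ?_
      rintro _ ⟨k, hk, rfl⟩
      obtain ⟨⟨a, j⟩, rfl⟩ := (indexEquiv n).surjective k
      rw [indexEquiv_val] at hk
      obtain rfl | rfl : a = 0 ∨ a = 1 := by omega
      · rw [row_zero_eq_plotkin]
        have hj : row n j ∈ spanAbove n i := Submodule.subset_span ⟨j, by simpa using hk, rfl⟩
        simpa using hj
      · rw [row_one_eq_plotkin]
        simp
    simpa using hle h
  · intro h
    have hleft : spanAbove n i ≤
        (spanAbove (n + 1) i).comap ((plotkin n).toLinearMap ∘ₗ LinearMap.inl (ZMod 2) _ _) := by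
      refine Submodule.span_le.2 ?_
      rintro _ ⟨j, hj, rfl⟩
      refine Submodule.subset_span ⟨indexEquiv n (0, j), by simpa [indexEquiv_val] using hj, ?_⟩
      simp [row_zero_eq_plotkin]
    have hright : Submodule.span (ZMod 2) (Set.range (row n)) ≤
        (spanAbove (n + 1) i).comap ((plotkin n).toLinearMap ∘ₗ LinearMap.inr (ZMod 2) _ _) := by
      refine Submodule.span_le.2 ?_
      rintro _ ⟨j, rfl⟩
      refine Submodule.subset_span ⟨indexEquiv n (1, j), ?_, ?_⟩
      · rw [indexEquiv_val, Fin.val_one]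
        omega
      · simp [row_one_eq_plotkin]
    have hu := hright (x := u) (span_range_row n ▸ Submodule.mem_top)
    have hsplit : plotkin n (y, u) = plotkin n (y, 0) + plotkin n (0, u) := by simp [← map_add]
    rw [hsplit]
    exact add_mem (hleft h) hu

theorem mem_oneCoset_iff (n : ℕ) (i : Fin (2 ^ n)) (x : Fin (2 ^ n) → ZMod 2) :
    x ∈ oneCoset n i ↔ x - row n i ∈ spanAbove n i :=
  ⟨fun ⟨v, hv, hx⟩ => by simpa [hx] using hv, fun h => ⟨_, h, by simp⟩⟩

theorem plotkin_mem_oneCoset (n : ℕ) (i : Fin (2 ^ n)) (y u : Fin (2 ^ n) → ZMod 2) :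
    plotkin n (y, u) ∈ oneCoset (n + 1) (indexEquiv n (0, i)) ↔ y ∈ oneCoset n i := by
  have hval : (indexEquiv n (0, i) : ℕ) = i := by simp [indexEquiv_val]
  rw [mem_oneCoset_iff, mem_oneCoset_iff, row_zero_eq_plotkin, ← map_sub, hval, Prod.mk_sub_mk,
    plotkin_mem_spanAbove n i i.2]

open Classical in
theorem S_eq_card (n : ℕ) (i : Fin (2 ^ n)) (w : ℕ) :
    S n i w = ((Finset.univ.filter (· ∈ oneCoset n i)).filter (hammingNorm · = w)).card := by
  rw [S, ← Set.ncard_coe_finset]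
  congr 1
  ext x
  simp

open Classical in
theorem S_succ_eq_sum (n : ℕ) (i : Fin (2 ^ n)) (w : ℕ) :
    S (n + 1) (indexEquiv n (0, i)) w = ∑ y with y ∈ oneCoset n i,
      (Finset.univ.filter fun u : Fin (2 ^ n) → ZMod 2 =>
        hammingNorm (y + u) + hammingNorm u = w).card := by
  rw [S_eq_card, Finset.filter_filter, Finset.card_filter, ← (plotkin n).toEquiv.sum_comp,
    Fintype.sum_prod_type, Finset.sum_filter]
  refine Finset.sum_congr rfl fun y _ => ?_
  simp only [LinearEquiv.coe_toEquiv, plotkin_mem_oneCoset, hammingNorm_plotkin]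
  by_cases hy : y ∈ oneCoset n i <;> simp [hy]

/-- For `n ≥ 1`, `N = 2^n` (written with `n+1`), `0 ≤ i < N/2`, and
`0 ≤ w ≤ N`: `S^{(n)}_{i,w} = Σ_{w'} S^{(n-1)}_{i,w'} · C(N/2 - w', (w-w')/2) · 2^{w'}`,
summed over `0 ≤ w' ≤ min(w, N/2)` with `w' ≡ w (mod 2)`. -/
theorem stmt_4 (n : ℕ) (i : ℕ) (hi : i < 2 ^ n) (w : ℕ) (hw : w ≤ 2 ^ (n + 1)) :
    S (n + 1) ⟨i, by rw [pow_succ]; omega⟩ w =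
      ∑ w' ∈ (Finset.range (min w (2 ^ n) + 1)).filter (fun w' => w' % 2 = w % 2),
        S n ⟨i, hi⟩ w' * (2 ^ n - w').choose ((w - w') / 2) * 2 ^ w' := by
  classical
  have hidx : (⟨i, by rw [pow_succ]; omega⟩ : Fin (2 ^ (n + 1))) = indexEquiv n (0, ⟨i, hi⟩) :=
    Fin.ext (by simp [indexEquiv_val])
  have hrange : (Finset.range (min w (2 ^ n) + 1)).filter (fun w' => w' % 2 = w % 2) =
      (Finset.range (2 ^ n + 1)).filter fun w' => w' ≤ w ∧ w' % 2 = w % 2 := by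
    ext w'
    simp only [Finset.mem_filter, Finset.mem_range]
    omega
  have hmaps : ∀ y ∈ Finset.univ.filter (· ∈ oneCoset n ⟨i, hi⟩),
      hammingNorm y ∈ Finset.range (2 ^ n + 1) := fun y _ => by
    have := hammingNorm_le_card_fintype (x := y)
    rw [Fintype.card_fin] at this
    exact Finset.mem_range.2 (by omega)
  rw [hidx, S_succ_eq_sum, hrange,
    ← Finset.sum_fiberwise_of_maps_to hmaps, Finset.sum_filter (s := Finset.range _)]
  refine Finset.sum_congr rfl fun w' _ => ?_
  rw [S_eq_card, mul_assoc, ← smul_eq_mul, ← smul_ite_zero, ← Finset.sum_const]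
  refine Finset.sum_congr rfl fun y hy => ?_
  rw [card_hammingNorm_add_eq, (Finset.mem_filter.1 hy).2, Fintype.card_fin]
end

section
/- Let N = 2^n and 0 ≤ i < N. The number of vectors of minimum Hamming weight 2^{p_{n-1}(i)} in the coset C^{(n)}(0^i, 1) equals s_i^{(n)} := S^{(n)}_{i, 2^{p_{n-1}(i)}} = 2^{Σ_{j=0}^{n-1} (1 − b_j(i)) 2^{p_j(i)}}. -/
open Finset
open scoped Matrix

/-- The splitting of an index of length `2 ^ (n + 1)` into its most significant bit and the rest. -/
def splitEquiv (n : ℕ) : Fin 2 × Fin (2 ^ n) ≃ Fin (2 ^ (n + 1)) :=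
  finProdFinEquiv.trans (finCongr (by ring))

theorem splitEquiv_val (n : ℕ) (a : Fin 2) (b : Fin (2 ^ n)) :
    (splitEquiv n (a, b) : ℕ) = b + 2 ^ n * a := by
  simp [splitEquiv]

theorem G_succ_apply (n : ℕ) (a a' : Fin 2) (b b' : Fin (2 ^ n)) :
    G (n + 1) (splitEquiv n (a, b)) (splitEquiv n (a', b')) = G2 a a' * G n b b' := by
  simp only [G, Matrix.reindex_apply, Matrix.submatrix_apply]
  change Matrix.kroneckerMap _ _ _ ((splitEquiv n).symm (splitEquiv n (a, b)))
    ((splitEquiv n).symm (splitEquiv n (a', b'))) = _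
  simp [Matrix.kroneckerMap_apply]

/-- The half of `x` at positions with most significant bit `a`. -/
def half {n : ℕ} (a : Fin 2) (x : Fin (2 ^ (n + 1)) → ZMod 2) : Fin (2 ^ n) → ZMod 2 :=
  fun b => x (splitEquiv n (a, b))

theorem vecMul_G_succ (n : ℕ) (x : Fin (2 ^ (n + 1)) → ZMod 2) (a : Fin 2) (b : Fin (2 ^ n)) :
    (x ᵥ* G (n + 1)) (splitEquiv n (a, b)) =
      G2 0 a * (half 0 x ᵥ* G n) b + G2 1 a * (half 1 x ᵥ* G n) b := by
  simp only [Matrix.vecMul, dotProduct]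
  rw [← (splitEquiv n).sum_comp, Fintype.sum_prod_type, Fin.sum_univ_two]
  simp only [G_succ_apply, half, Finset.mul_sum]
  congr 1 <;> exact Finset.sum_congr rfl fun _ _ => by ring

theorem vecMul_G_zero_half (n : ℕ) (x : Fin (2 ^ (n + 1)) → ZMod 2) (b : Fin (2 ^ n)) :
    (x ᵥ* G (n + 1)) (splitEquiv n (0, b)) = ((half 0 x + half 1 x) ᵥ* G n) b := by
  simp [vecMul_G_succ, G2, Matrix.add_vecMul]

theorem vecMul_G_one_half (n : ℕ) (x : Fin (2 ^ (n + 1)) → ZMod 2) (b : Fin (2 ^ n)) :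
    (x ᵥ* G (n + 1)) (splitEquiv n (1, b)) = (half 1 x ᵥ* G n) b := by
  simp [vecMul_G_succ, G2]

theorem vecMul_G_vecMul_G (n : ℕ) (x : Fin (2 ^ n) → ZMod 2) : (x ᵥ* G n) ᵥ* G n = x := by
  induction n with
  | zero => simp [G]
  | succ n ih =>
    have h0 : half 0 (x ᵥ* G (n + 1)) = (half 0 x + half 1 x) ᵥ* G n :=
      funext (vecMul_G_zero_half n x)
    have h1 : half 1 (x ᵥ* G (n + 1)) = half 1 x ᵥ* G n := funext (vecMul_G_one_half n x)
    funext k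
    obtain ⟨⟨a, b⟩, rfl⟩ := (splitEquiv n).surjective k
    fin_cases a
    · change ((x ᵥ* G (n + 1)) ᵥ* G (n + 1)) (splitEquiv n (0, b)) = x (splitEquiv n (0, b))
      rw [vecMul_G_zero_half, Matrix.add_vecMul, h0, h1, ih, ih, add_assoc, CharTwo.add_self_eq_zero,
        add_zero, half]
    · change ((x ᵥ* G (n + 1)) ᵥ* G (n + 1)) (splitEquiv n (1, b)) = x (splitEquiv n (1, b))
      rw [vecMul_G_one_half, h1, ih, half]

theorem vecMul_G_eq_zero {n : ℕ} {x : Fin (2 ^ n) → ZMod 2} : x ᵥ* G n = 0 ↔ x = 0 := by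
  refine ⟨fun h => ?_, fun h => by simp [h]⟩
  rw [← vecMul_G_vecMul_G n x, h, Matrix.zero_vecMul]

theorem vecMul_G_row (n : ℕ) (i : Fin (2 ^ n)) : row n i ᵥ* G n = Pi.single i 1 := by
  have h : row n i = Pi.single i 1 ᵥ* G n := by simp [row, Matrix.row]
  rw [h, vecMul_G_vecMul_G]

theorem mem_spanAbove_iff {n : ℕ} {i : ℕ} {v : Fin (2 ^ n) → ZMod 2} :
    v ∈ spanAbove n i ↔ ∀ j : Fin (2 ^ n), (j : ℕ) ≤ i → (v ᵥ* G n) j = 0 := by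
  constructor
  · intro hv
    induction hv using Submodule.span_induction with
    | mem v hv =>
      obtain ⟨k, hk, rfl⟩ := hv
      intro j hj
      rw [vecMul_G_row, Pi.single_eq_of_ne]
      rintro rfl
      omega
    | zero => simp
    | add v w _ _ hv hw => intro j hj; simp [Matrix.add_vecMul, hv j hj, hw j hj]
    | smul c v _ hv => intro j hj; simp [Matrix.smul_vecMul, hv j hj]
  · intro h
    rw [← vecMul_G_vecMul_G n v, Matrix.vecMul_eq_sum]
    refine Submodule.sum_mem _ fun j _ => ?_
    by_cases hj : (j : ℕ) ≤ i
    · simp [h j hj]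
    · exact Submodule.smul_mem _ _ (Submodule.subset_span ⟨j, by omega, rfl⟩)

theorem mem_oneCoset_iff_s8 {n : ℕ} {i : Fin (2 ^ n)} {x : Fin (2 ^ n) → ZMod 2} :
    x ∈ oneCoset n i ↔ (∀ j < i, (x ᵥ* G n) j = 0) ∧ (x ᵥ* G n) i = 1 := by
  have h : x ∈ oneCoset n i ↔ x - row n i ∈ spanAbove n i := by
    constructor
    · rintro ⟨v, hv, rfl⟩
      simpa using hv
    · exact fun h => ⟨_, h, by abel⟩
  rw [h, mem_spanAbove_iff]
  simp only [Matrix.sub_vecMul, vecMul_G_row, Pi.sub_apply]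
  constructor
  · intro h
    refine ⟨fun j hj => ?_, ?_⟩
    · simpa [Pi.single_eq_of_ne hj.ne] using h j hj.le
    · simpa [sub_eq_zero] using h i le_rfl
  · rintro ⟨h0, h1⟩ j hj
    rcases (show j ≤ i from hj).lt_or_eq with hj | rfl
    · simp [Pi.single_eq_of_ne hj.ne, h0 j hj]
    · simp [h1]

theorem mem_oneCoset_zero_half {n : ℕ} {b : Fin (2 ^ n)} {x : Fin (2 ^ (n + 1)) → ZMod 2} :
    x ∈ oneCoset (n + 1) (splitEquiv n (0, b)) ↔ half 0 x + half 1 x ∈ oneCoset n b := by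
  simp only [mem_oneCoset_iff_s8, vecMul_G_zero_half]
  refine and_congr_left fun _ => ⟨fun h j hj => ?_, fun h j hj => ?_⟩
  · rw [← vecMul_G_zero_half]
    refine h _ ?_
    rwa [Fin.lt_def, splitEquiv_val, splitEquiv_val, Nat.add_lt_add_iff_right]
  · obtain ⟨⟨a, c⟩, rfl⟩ := (splitEquiv n).surjective j
    rw [Fin.lt_def, splitEquiv_val, splitEquiv_val] at hj
    fin_cases a
    · exact (vecMul_G_zero_half n x c).trans (h c (by simpa using hj))
    · have hj : (c : ℕ) + 2 ^ n * 1 < b + 2 ^ n * 0 := hj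
      omega

theorem mem_oneCoset_one_half {n : ℕ} {b : Fin (2 ^ n)} {x : Fin (2 ^ (n + 1)) → ZMod 2} :
    x ∈ oneCoset (n + 1) (splitEquiv n (1, b)) ↔ half 0 x = half 1 x ∧ half 1 x ∈ oneCoset n b := by
  have hsum : half 0 x = half 1 x ↔ ∀ c, ((half 0 x + half 1 x) ᵥ* G n) c = 0 := by
    rw [← CharTwo.add_eq_zero, ← vecMul_G_eq_zero, funext_iff]
    rfl
  simp only [mem_oneCoset_iff_s8, vecMul_G_one_half, hsum, ← and_assoc]
  refine and_congr_left fun _ => ⟨fun h => ⟨fun c => ?_, fun c hc => ?_⟩, fun h j hj => ?_⟩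
  · rw [← vecMul_G_zero_half]
    refine h _ ?_
    rw [Fin.lt_def, splitEquiv_val, splitEquiv_val]
    change (c : ℕ) + 2 ^ n * 0 < b + 2 ^ n * 1
    omega
  · rw [← vecMul_G_one_half]
    refine h _ ?_
    rwa [Fin.lt_def, splitEquiv_val, splitEquiv_val, Nat.add_lt_add_iff_right]
  · obtain ⟨⟨a, c⟩, rfl⟩ := (splitEquiv n).surjective j
    rw [Fin.lt_def, splitEquiv_val, splitEquiv_val] at hj
    fin_cases a
    · exact (vecMul_G_zero_half n x c).trans (h.1 c)
    · exact (vecMul_G_one_half n x c).trans (h.2 c (by simpa using hj))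

theorem hammingNorm_eq_half_add_half {n : ℕ} (x : Fin (2 ^ (n + 1)) → ZMod 2) :
    hammingNorm x = hammingNorm (half 0 x) + hammingNorm (half 1 x) := by
  simp only [hammingNorm, Finset.card_filter]
  rw [← (splitEquiv n).sum_comp, Fintype.sum_prod_type, Fin.sum_univ_two]
  rfl

theorem hammingNorm_add_add_hammingNorm {ι : Type*} [Fintype ι] (u v : ι → ZMod 2) :
    hammingNorm u + hammingNorm v =
      hammingNorm (u + v) + 2 * #{k | u k + v k = 0 ∧ v k ≠ 0} := by
  simp only [hammingNorm, Finset.card_filter, Finset.mul_sum, ← Finset.sum_add_distrib]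
  refine Finset.sum_congr rfl fun k _ => ?_
  have h : ∀ a b : ZMod 2, ((if a ≠ 0 then 1 else 0) + if b ≠ 0 then 1 else 0) =
      (if a + b ≠ 0 then 1 else 0) + 2 * if a + b = 0 ∧ b ≠ 0 then 1 else 0 := by decide
  convert h (u k) (v k)
  rfl

theorem card_support_subset {ι : Type*} [Fintype ι] [DecidableEq ι] (u : ι → ZMod 2) :
    #{v : ι → ZMod 2 | ∀ k, u k = 0 → v k = 0} = 2 ^ hammingNorm u := by
  have h : ({v : ι → ZMod 2 | ∀ k, u k = 0 → v k = 0} : Finset (ι → ZMod 2)) =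
      Fintype.piFinset fun k => if u k = 0 then {0} else univ := by
    ext v
    simp only [mem_filter, mem_univ, true_and, Fintype.mem_piFinset]
    refine forall_congr' fun k => ?_
    split_ifs <;> simp_all
  rw [h, Fintype.card_piFinset, hammingNorm, Finset.card_filter, ← Finset.prod_pow_eq_pow_sum]
  refine Finset.prod_congr rfl fun k _ => ?_
  split_ifs <;> simp_all [ZMod.card]

theorem hammingNorm_add_eq_iff {ι : Type*} [Fintype ι] (u v : ι → ZMod 2) :
    hammingNorm u + hammingNorm v = hammingNorm (u + v) ↔ ∀ k, (u + v) k = 0 → v k = 0 := by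
  rw [hammingNorm_add_add_hammingNorm]
  simp [Finset.filter_eq_empty_iff]

/-- A vector of length `2 ^ (n + 1)` as the pair of the sum of its halves and its upper half. -/
def sumHalfEquiv (n : ℕ) :
    (Fin (2 ^ (n + 1)) → ZMod 2) ≃ (Fin (2 ^ n) → ZMod 2) × (Fin (2 ^ n) → ZMod 2) where
  toFun x := (half 0 x + half 1 x, half 1 x)
  invFun p k := if ((splitEquiv n).symm k).1 = 0 then (p.1 + p.2) ((splitEquiv n).symm k).2
    else p.2 ((splitEquiv n).symm k).2
  left_inv x := by
    funext k
    obtain ⟨⟨a, b⟩, rfl⟩ := (splitEquiv n).surjective k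
    fin_cases a <;> simp [half, add_assoc, CharTwo.add_self_eq_zero]
  right_inv p := by
    ext k <;> simp [half, add_assoc, CharTwo.add_self_eq_zero]

theorem sumHalfEquiv_apply {n : ℕ} (x : Fin (2 ^ (n + 1)) → ZMod 2) :
    sumHalfEquiv n x = (half 0 x + half 1 x, half 1 x) :=
  rfl

theorem S_zero_half {n : ℕ} {b : Fin (2 ^ n)} {w : ℕ}
    (hw : ∀ u ∈ oneCoset n b, w ≤ hammingNorm u) :
    S (n + 1) (splitEquiv n (0, b)) w = S n b w * 2 ^ w := by
  classical
  have himage : sumHalfEquiv n ''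
      {x ∈ oneCoset (n + 1) (splitEquiv n (0, b)) | hammingNorm x = w} =
      ((({u | u ∈ oneCoset n b ∧ hammingNorm u = w} : Finset (Fin (2 ^ n) → ZMod 2)).sigma
        fun u => ({v | ∀ k, u k = 0 → v k = 0} : Finset (Fin (2 ^ n) → ZMod 2))).map
          (Equiv.sigmaEquivProd _ _).toEmbedding :
            Set ((Fin (2 ^ n) → ZMod 2) × (Fin (2 ^ n) → ZMod 2))) := by
    rw [Equiv.image_eq_preimage_symm]
    ext p
    obtain ⟨x, rfl⟩ := (sumHalfEquiv n).surjective p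
    rw [Set.mem_preimage, Equiv.symm_apply_apply, Finset.mem_coe, Finset.mem_map_equiv]
    simp only [Set.mem_ofPred_eq, mem_oneCoset_zero_half, Finset.mem_sigma, Finset.mem_filter,
      Finset.mem_univ, true_and, and_assoc, sumHalfEquiv_apply, Equiv.sigmaEquivProd_symm_apply]
    refine and_congr_right fun hx => ?_
    rw [← hammingNorm_add_eq_iff, hammingNorm_eq_half_add_half]
    have h1 := hammingNorm_add_add_hammingNorm (half 0 x) (half 1 x)
    have h2 := hw _ hx
    omega
  rw [S, ← Set.ncard_image_of_injective _ (sumHalfEquiv n).injective, himage,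
    Set.ncard_coe_finset, Finset.card_map, Finset.card_sigma,
    Finset.sum_congr rfl (g := fun _ => 2 ^ w), Finset.sum_const, smul_eq_mul, S,
    ← Set.ncard_coe_finset]
  · simp
  · intro u hu
    rw [← (Finset.mem_filter.1 hu).2.2]
    convert card_support_subset u

theorem S_one_half {n : ℕ} {b : Fin (2 ^ n)} {w : ℕ} :
    S (n + 1) (splitEquiv n (1, b)) (w * 2) = S n b w := by
  have himage : sumHalfEquiv n ''
      {x ∈ oneCoset (n + 1) (splitEquiv n (1, b)) | hammingNorm x = w * 2} =
      (fun u => (0, u)) '' {u ∈ oneCoset n b | hammingNorm u = w} := by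
    rw [Equiv.image_eq_preimage_symm]
    ext p
    obtain ⟨x, rfl⟩ := (sumHalfEquiv n).surjective p
    rw [Set.mem_preimage, Equiv.symm_apply_apply]
    simp only [Set.mem_ofPred_eq, mem_oneCoset_one_half,
      Set.mem_image, sumHalfEquiv_apply, Prod.mk.injEq, hammingNorm_eq_half_add_half x]
    constructor
    · rintro ⟨⟨h, hx⟩, hn⟩
      refine ⟨half 1 x, ⟨hx, ?_⟩, by rw [h, CharTwo.add_self_eq_zero], rfl⟩
      rw [h] at hn
      omega
    · rintro ⟨u, ⟨hx, hn⟩, h, rfl⟩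
      have h := CharTwo.add_eq_zero.1 h.symm
      refine ⟨⟨h, hx⟩, ?_⟩
      rw [h]
      omega
  rw [S, ← Set.ncard_image_of_injective _ (sumHalfEquiv n).injective, himage,
    Set.ncard_image_of_injective _ (Prod.mk_right_injective 0), S]

theorem bit_add_two_pow_mul {n j : ℕ} (hj : j < n) (b a : ℕ) :
    bit (b + 2 ^ n * a) j = bit b j := by
  obtain ⟨k, rfl⟩ := Nat.exists_eq_add_of_lt hj
  rw [bit, bit, show b + 2 ^ (j + k + 1) * a = b + 2 ^ j * (2 * (2 ^ k * a)) by ring,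
    Nat.add_mul_div_left _ _ (by positivity), Nat.add_mul_mod_self_left]

theorem bit_splitEquiv_of_lt {n j : ℕ} (hj : j < n) (a : Fin 2) (b : Fin (2 ^ n)) :
    bit (splitEquiv n (a, b)) j = bit b j := by
  rw [splitEquiv_val, bit_add_two_pow_mul hj]

theorem bit_splitEquiv_self {n : ℕ} (a : Fin 2) (b : Fin (2 ^ n)) :
    bit (splitEquiv n (a, b)) n = a := by
  rw [splitEquiv_val, bit, Nat.add_mul_div_left _ _ (by positivity), Nat.div_eq_of_lt b.2, zero_add,
    Nat.mod_eq_of_lt a.2]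

theorem sum_bit_splitEquiv {n m : ℕ} (hm : m ≤ n) (a : Fin 2) (b : Fin (2 ^ n)) :
    ∑ s ∈ range m, bit (splitEquiv n (a, b)) s = ∑ s ∈ range m, bit b s :=
  Finset.sum_congr rfl fun _ hs => bit_splitEquiv_of_lt ((mem_range.1 hs).trans_le hm) a b

theorem sum_bit_succ_splitEquiv {n : ℕ} (a : Fin 2) (b : Fin (2 ^ n)) :
    ∑ s ∈ range (n + 1), bit (splitEquiv n (a, b)) s = ∑ s ∈ range n, bit b s + a := by
  rw [Finset.sum_range_succ, sum_bit_splitEquiv le_rfl, bit_splitEquiv_self]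

theorem two_pow_sum_bit_le_hammingNorm {n : ℕ} {i : Fin (2 ^ n)} {x : Fin (2 ^ n) → ZMod 2}
    (hx : x ∈ oneCoset n i) : 2 ^ (∑ s ∈ range n, bit i s) ≤ hammingNorm x := by
  induction n with
  | zero =>
    rw [range_zero, sum_empty]
    change 0 < hammingNorm x
    rw [hammingNorm_pos_iff]
    rintro rfl
    simpa using (mem_oneCoset_iff_s8.1 hx).2
  | succ n ih =>
    obtain ⟨⟨a, b⟩, rfl⟩ := (splitEquiv n).surjective i
    rw [sum_bit_succ_splitEquiv, hammingNorm_eq_half_add_half]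
    obtain rfl | rfl : a = 0 ∨ a = 1 := by omega
    · have h := ih (mem_oneCoset_zero_half.1 hx)
      have h' := hammingNorm_add_add_hammingNorm (half 0 x) (half 1 x)
      simp only [Fin.val_zero, add_zero]
      omega
    · obtain ⟨heq, hmem⟩ := mem_oneCoset_one_half.1 hx
      have h := ih hmem
      rw [heq, Fin.val_one, pow_succ]
      omega

theorem S_min_weight (n : ℕ) (i : Fin (2 ^ n)) :
    S n i (2 ^ (∑ s ∈ range n, bit i s)) =
      2 ^ (∑ j ∈ range n, (1 - bit i j) * 2 ^ (∑ s ∈ range (j + 1), bit i s)) := by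
  induction n with
  | zero =>
    have : Subsingleton (Fin (2 ^ 0)) := inferInstanceAs (Subsingleton (Fin 1))
    rw [range_zero, sum_empty, sum_empty, pow_zero, S, Set.ncard_eq_one]
    refine ⟨1, Set.ext fun x => ?_⟩
    have hi : i = 0 := Subsingleton.elim _ _
    subst hi
    simp only [Set.mem_ofPred_eq, Set.mem_singleton_iff, mem_oneCoset_iff_s8, G, Matrix.vecMul_one]
    constructor
    · rintro ⟨⟨-, h⟩, -⟩
      funext k
      rw [Subsingleton.elim k 0, h, Pi.one_apply]
    · rintro rfl
      exact ⟨⟨fun j hj => absurd hj (by simp), rfl⟩, by simp [hammingNorm]⟩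
  | succ n ih =>
    obtain ⟨⟨a, b⟩, rfl⟩ := (splitEquiv n).surjective i
    have hsum : ∑ j ∈ range n, (1 - bit (splitEquiv n (a, b)) j) *
          2 ^ (∑ s ∈ range (j + 1), bit (splitEquiv n (a, b)) s) =
        ∑ j ∈ range n, (1 - bit b j) * 2 ^ (∑ s ∈ range (j + 1), bit b s) :=
      Finset.sum_congr rfl fun j hj => by
        rw [bit_splitEquiv_of_lt (mem_range.1 hj), sum_bit_splitEquiv (mem_range.1 hj)]
    rw [sum_bit_succ_splitEquiv, Finset.sum_range_succ _ n, hsum, sum_bit_succ_splitEquiv,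
      bit_splitEquiv_self, pow_add _ (∑ s ∈ range n, _), pow_add _ (∑ j ∈ range n, _), ← ih b]
    obtain rfl | rfl : a = 0 ∨ a = 1 := by omega
    · simpa using S_zero_half fun u hu => two_pow_sum_bit_le_hammingNorm hu
    · simpa [pow_succ] using S_one_half

/-- For `N = 2^n` and `0 ≤ i < N`, the number of minimum-weight
(`= 2^{p_{n-1}(i)}`) vectors in `C^{(n)}(0^i, 1)` is
`s_i^{(n)} = 2^{Σ_{j=0}^{n-1} (1 - b_j(i)) 2^{p_j(i)}}`, with `p_j(i) = Σ_{s=0}^{j} b_s(i)`. -/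
theorem stmt_8 (n : ℕ) (i : ℕ) (hi : i < 2 ^ n) :
    S n ⟨i, hi⟩ (2 ^ (∑ s ∈ Finset.range n, bit i s)) =
      2 ^ (∑ j ∈ Finset.range n, (1 - bit i j) * 2 ^ (∑ s ∈ Finset.range (j + 1), bit i s)) :=
  S_min_weight n ⟨i, hi⟩
end

section
/- Let 0 ≤ j < k < 2^n, and let ℓ ∈ [0, n) be any index such that b_ℓ(j) ≥ b_ℓ(k). Then f_ℓ(j) < f_ℓ(k). -/
/-- `delBit n l k = Σ_{r=0}^{l-1} b_r(k) 2^r + Σ_{r=l+1}^{n-1} b_r(k) 2^{r-1}` is the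
integer obtained from `k < 2^n` by deleting the `l`-th bit of its binary representation. -/
def delBit (n l k : ℕ) : ℕ :=
  ∑ r ∈ Finset.range l, bit k r * 2 ^ r + ∑ r ∈ Finset.Ico (l + 1) n, bit k r * 2 ^ (r - 1)

theorem sum_range_bit_mul_two_pow (k n : ℕ) :
    ∑ r ∈ Finset.range n, bit k r * 2 ^ r = k % 2 ^ n := by
  induction n with
  | zero => simp [Nat.mod_one]
  | succ n ih => rw [Finset.sum_range_succ, ih, Nat.mod_pow_succ, bit, mul_comm (2 ^ n)]

theorem bit_add (k a i : ℕ) : bit k (a + i) = bit (k / 2 ^ a) i := by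
  rw [bit, bit, Nat.div_div_eq_div_mul, pow_add]

theorem delBit_eq {n l k : ℕ} (hk : k < 2 ^ n) (hl : l < n) :
    delBit n l k = k % 2 ^ l + 2 ^ l * (k / 2 ^ (l + 1)) := by
  have hq : k / 2 ^ (l + 1) < 2 ^ (n - (l + 1)) := by
    rw [Nat.div_lt_iff_lt_mul (by positivity), ← pow_add, Nat.sub_add_cancel hl]
    exact hk
  have hsum : ∑ i ∈ Finset.range (n - (l + 1)), bit k (l + 1 + i) * 2 ^ (l + 1 + i - 1) =
      2 ^ l * ∑ i ∈ Finset.range (n - (l + 1)), bit (k / 2 ^ (l + 1)) i * 2 ^ i := by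
    rw [Finset.mul_sum]
    refine Finset.sum_congr rfl fun i _ => ?_
    rw [bit_add, show l + 1 + i - 1 = l + i by omega, pow_add]
    ring
  rw [delBit, sum_range_bit_mul_two_pow, Finset.sum_Ico_eq_sum_range, hsum,
    sum_range_bit_mul_two_pow, Nat.mod_eq_of_lt hq]

theorem eq_mod_add_bit_add_div (k l : ℕ) :
    k = k % 2 ^ l + 2 ^ l * (bit k l + 2 * (k / 2 ^ (l + 1))) := by
  rw [pow_succ, ← Nat.div_div_eq_div_mul, bit, Nat.mod_add_div, Nat.mod_add_div]

/-- Let `0 ≤ j < k < 2^n` and let `l < n` be any index with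
`b_l(j) ≥ b_l(k)`. Then `f_l(j) < f_l(k)`. -/
theorem stmt_16 (n j k l : ℕ) (hjk : j < k) (hk : k < 2 ^ n) (hl : l < n)
    (hb : bit k l ≤ bit j l) : delBit n l j < delBit n l k := by
  rw [delBit_eq (hjk.trans hk) hl, delBit_eq hk hl]
  have hj_mod : j % 2 ^ l < 2 ^ l := Nat.mod_lt _ (by positivity)
  have hq : j / 2 ^ (l + 1) ≤ k / 2 ^ (l + 1) := Nat.div_le_div_right hjk.le
  rcases hq.lt_or_eq with hq | hq
  · have := Nat.mul_le_mul_left (2 ^ l) (Nat.succ_le_of_lt hq)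
    rw [Nat.mul_succ] at this
    omega
  · have hj_eq := eq_mod_add_bit_add_div j l
    have hk_eq := eq_mod_add_bit_add_div k l
    rw [hq] at hj_eq ⊢
    have := Nat.mul_le_mul_left (2 ^ l) (Nat.add_le_add_right hb (2 * (k / 2 ^ (l + 1))))
    omega
end
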